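/- arXiv:0905.3839 — 2 statements merged into one kernel-verified Lean document; each statement's English description precedes it below -/
import Mathlib

section
/- Sharp bound for the fractional maximal operator: Let 0 ≤ α < n, 1 < p < n/α, and define q by 1/q = 1/p − α/n. Then there is a constant c = c(n,α,p) such that for every weight w ∈ A_{p,q} and every measurable f, ‖w·M_α f‖_{L^{q}(ℝⁿ)} ≤ c [w]_{A_{p,q}}^{(p′/q)(1−α/n)} ‖w·f‖_{L^{p}(ℝⁿ)}. -/
open MeasureTheory ENNReal Set

noncomputable section

/-- Euclidean space `ℝⁿ`. -/
abbrev Euc (n : ℕ) := EuclideanSpace ℝ (Fin n)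

variable {n : ℕ}

/-- The axis-parallel closed cube with lower corner `a` and side length `h`. -/
def Cube (a : Euc n) (h : ℝ) : Set (Euc n) :=
  {x | ∀ i, a i ≤ x i ∧ x i ≤ a i + h}

/-- The weighted measure `u(E) = ∫_E u dx` of a set. -/
def wMeas (u : Euc n → ℝ) (E : Set (Euc n)) : ℝ≥0∞ :=
  ∫⁻ x in E, ENNReal.ofReal (u x)

/-- The dual exponent `p' = p/(p-1)`. -/
def dualExp (p : ℝ) : ℝ := p / (p - 1)

/-- The `A_{p,q}` constant of a weight `w` (with the `A_{1,q}` convention when `p = 1`). -/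
def Apq (p q : ℝ) (w : Euc n → ℝ) : ℝ≥0∞ :=
  ⨆ (a : Euc n) (h : ℝ) (_ : 0 < h),
    ((volume (Cube a h))⁻¹ * ∫⁻ x in Cube a h, ENNReal.ofReal (w x) ^ q) *
      (if p = 1 then
        (essSup (fun x => (ENNReal.ofReal (w x))⁻¹) (volume.restrict (Cube a h))) ^ q
      else
        ((volume (Cube a h))⁻¹ * ∫⁻ x in Cube a h,
            ENNReal.ofReal (w x) ^ (-(dualExp p))) ^ (q / dualExp p))

/-- The weighted Lebesgue norm `‖w f‖_{L^p(ℝⁿ)}`. -/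
def wLp (w f : Euc n → ℝ) (p : ℝ) : ℝ≥0∞ :=
  (∫⁻ x, (ENNReal.ofReal (w x) * ENNReal.ofReal |f x|) ^ p) ^ (1 / p)

/-- The weighted Lebesgue norm `‖w g‖_{L^q(ℝⁿ)}` of an `ℝ≥0∞`-valued function. -/
def wLpE (w : Euc n → ℝ) (g : Euc n → ℝ≥0∞) (q : ℝ) : ℝ≥0∞ :=
  (∫⁻ x, (ENNReal.ofReal (w x) * g x) ^ q) ^ (1 / q)

/-- The weak norm `‖g‖_{L^{q,∞}(u)} = sup_{λ>0} λ u({|g|>λ})^{1/q}`. -/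
def weakLp (u : Euc n → ℝ) (g : Euc n → ℝ) (q : ℝ) : ℝ≥0∞ :=
  ⨆ (t : ℝ) (_ : 0 < t), ENNReal.ofReal t * wMeas u {x | t < |g x|} ^ (1 / q)

/-- The weak norm of an `ℝ≥0∞`-valued function. -/
def weakLpE (u : Euc n → ℝ) (g : Euc n → ℝ≥0∞) (q : ℝ) : ℝ≥0∞ :=
  ⨆ (t : ℝ) (_ : 0 < t), ENNReal.ofReal t * wMeas u {x | ENNReal.ofReal t < g x} ^ (1 / q)

/-- The fractional integral (Riesz potential) `I_α f(x) = ∫ |f(y)| |x-y|^{α-n} dy`. -/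
def riesz (α : ℝ) (f : Euc n → ℝ) (x : Euc n) : ℝ≥0∞ :=
  ∫⁻ y, ENNReal.ofReal |f y| * ENNReal.ofReal (‖x - y‖ ^ (α - (n : ℝ)))

/-- The fractional maximal operator `M_α f(x) = sup_{Q ∋ x} |Q|^{α/n-1} ∫_Q |f|`. -/
def fracMax (α : ℝ) (f : Euc n → ℝ) (x : Euc n) : ℝ≥0∞ :=
  ⨆ (a : Euc n) (h : ℝ) (_ : 0 < h) (_ : x ∈ Cube a h),
    volume (Cube a h) ^ (α / (n : ℝ) - 1) * ∫⁻ y in Cube a h, ENNReal.ofReal |f y|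


lemma weak_besicovitch (X : Type*) [MetricSpace X] [SecondCountableTopology X]
    [HasBesicovitchCovering X] [MeasurableSpace X] [OpensMeasurableSpace X] :
    ∃ N : ℕ, ∀ (μ ν : Measure X) (c : ℝ≥0∞),
      c * μ {x | ∃ r : ℚ, 0 < r ∧ c * μ (Metric.ball x r) < ν (Metric.ball x r)} ≤ N * ν univ := by
  obtain ⟨N, τ, hτ, hN⟩ := HasBesicovitchCovering.no_satelliteConfig (α := X)
  refine ⟨N, fun μ ν c => ?_⟩
  set E : ℕ → Set X := fun R =>
    {x | ∃ r : ℚ, 0 < r ∧ (r : ℝ) ≤ R ∧ c * μ (Metric.ball x r) < ν (Metric.ball x r)} with hE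
  have hmono : Monotone E := by
    intro a b hab x ⟨r, h1, h2, h3⟩
    exact ⟨r, h1, h2.trans (by exact_mod_cast hab), h3⟩
  have hU : {x | ∃ r : ℚ, 0 < r ∧ c * μ (Metric.ball x r) < ν (Metric.ball x r)} = ⋃ R, E R := by
    ext x
    simp only [mem_ofPred_eq, mem_iUnion, hE]
    constructor
    · rintro ⟨r, h1, h2⟩
      obtain ⟨R, hR⟩ := exists_nat_ge (r : ℝ)
      exact ⟨R, r, h1, hR, h2⟩
    · rintro ⟨R, r, h1, _, h2⟩
      exact ⟨r, h1, h2⟩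
  rw [hU, hmono.measure_iUnion, ENNReal.mul_iSup]
  refine iSup_le fun R => ?_
  have hch : ∀ x : E R, ∃ r : ℚ, 0 < r ∧ (r : ℝ) ≤ R ∧
      c * μ (Metric.ball (x : X) r) < ν (Metric.ball (x : X) r) := fun x => x.2
  choose ρ hρ0 hρR hρ using hch
  let Q : Besicovitch.BallPackage (E R) X :=
    { c := fun x => x
      r := fun x => ρ x
      rpos := fun x => by exact_mod_cast hρ0 x
      r_bound := R
      r_le := hρR }
  obtain ⟨s, hs, hcov⟩ := Besicovitch.exist_disjoint_covering_families hτ hN Q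
  have hcov' : E R ⊆ ⋃ i : Fin N, ⋃ j ∈ s i, Metric.ball (j : X) (ρ j) := by
    have : range Q.c = E R := Subtype.range_coe
    exact this.symm.subset.trans hcov
  have hdisj : ∀ i, (s i).PairwiseDisjoint fun j => Metric.ball (j : X) (ρ j) := fun i a ha b hb hab =>
    (hs i ha hb hab).mono Metric.ball_subset_closedBall Metric.ball_subset_closedBall
  have hcount : ∀ i, (s i).Countable := fun i =>
    (hdisj i).countable_of_isOpen (fun j _ => Metric.isOpen_ball)
      (fun j _ => ⟨j, Metric.mem_ball_self (by exact_mod_cast hρ0 j)⟩)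
  have hi : ∀ i, c * μ (⋃ j ∈ s i, Metric.ball (j : X) (ρ j)) ≤ ν univ := by
    intro i
    rw [measure_biUnion (hcount i) (hdisj i) (fun _ _ => Metric.isOpen_ball.measurableSet),
      ← ENNReal.tsum_mul_left]
    calc ∑' j : s i, c * μ (Metric.ball ((j : E R) : X) (ρ j))
        ≤ ∑' j : s i, ν (Metric.ball ((j : E R) : X) (ρ j)) :=
          ENNReal.tsum_le_tsum fun j => (hρ j).le
      _ = ν (⋃ j ∈ s i, Metric.ball (j : X) (ρ j)) :=
          (measure_biUnion (hcount i) (hdisj i) (fun _ _ => Metric.isOpen_ball.measurableSet)).symm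
      _ ≤ ν univ := measure_mono (subset_univ _)
  calc c * μ (E R) ≤ c * ∑ i : Fin N, μ (⋃ j ∈ s i, Metric.ball (j : X) (ρ j)) := by
        gcongr
        refine (measure_mono hcov').trans ?_
        exact measure_iUnion_fintype_le _ _
    _ = ∑ i : Fin N, c * μ (⋃ j ∈ s i, Metric.ball (j : X) (ρ j)) := Finset.mul_sum _ _ _
    _ ≤ ∑ i : Fin N, ν univ := Finset.sum_le_sum fun i _ => hi i
    _ = N * ν univ := by simp

lemma layer_pt (p : ℝ) (hp : 0 < p) (a : ℝ≥0∞) :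
    ENNReal.ofReal p * ∫⁻ t in Ioi (0 : ℝ), {t : ℝ | ENNReal.ofReal t < a}.indicator
      (fun t => ENNReal.ofReal (t ^ (p - 1))) t = a ^ p := by
  have fin : ∀ b : ℝ, 0 ≤ b → ENNReal.ofReal p * ∫⁻ t in Ioi (0 : ℝ),
      {t : ℝ | ENNReal.ofReal t < ENNReal.ofReal b}.indicator
      (fun t => ENNReal.ofReal (t ^ (p - 1))) t = ENNReal.ofReal b ^ p := by
    intro b hb
    have h := lintegral_rpow_eq_lintegral_meas_lt_mul (Measure.dirac (0 : ℝ)) (f := fun _ => b)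
      (Filter.Eventually.of_forall fun _ => hb) aemeasurable_const hp
    simp only [lintegral_const, measure_univ, mul_one] at h
    rw [ENNReal.ofReal_rpow_of_nonneg hb hp.le, h]
    congr 1
    refine setLIntegral_congr_fun measurableSet_Ioi fun t ht => ?_
    have ht' : (0 : ℝ) < t := ht
    by_cases htb : t < b
    · have : ENNReal.ofReal t < ENNReal.ofReal b :=
        (ENNReal.ofReal_lt_ofReal_iff_of_nonneg ht'.le).2 htb
      simp [indicator, this, htb]
    · have : ¬ ENNReal.ofReal t < ENNReal.ofReal b := fun h =>
        htb ((ENNReal.ofReal_lt_ofReal_iff_of_nonneg ht'.le).1 h)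
      simp [indicator, this, htb]
  by_cases ha : a = ⊤
  · subst ha
    rw [ENNReal.top_rpow_of_pos hp, eq_top_iff]
    refine le_of_forall_lt fun c hc => ?_
    obtain ⟨k, hk⟩ := ENNReal.exists_nat_gt (r := c ^ (1/p)) (by
      exact (ENNReal.rpow_lt_top_of_nonneg (by positivity) hc.ne).ne)
    have h1 : c < (k : ℝ≥0∞) ^ p := by
      have := ENNReal.rpow_lt_rpow hk hp
      rwa [← ENNReal.rpow_mul, one_div_mul_cancel hp.ne', ENNReal.rpow_one] at this
    refine h1.trans_le ?_
    have h2 := fin k (by positivity)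
    rw [ENNReal.ofReal_natCast] at h2
    rw [← h2]
    refine mul_le_mul_right (lintegral_mono fun t => ?_) _
    simp only [ENNReal.ofReal_lt_top, indicator, mem_ofPred_eq, if_true]
    split_ifs <;> simp
  · have := fin a.toReal ENNReal.toReal_nonneg
    rwa [ENNReal.ofReal_toReal ha] at this

lemma layer_meas {X : Type*} [MeasurableSpace X] (μ : Measure X) [SFinite μ] (p : ℝ) (hp : 0 < p)
    (F G : X → ℝ≥0∞) (hF : Measurable F) (hG : Measurable G) :
    ENNReal.ofReal p * ∫⁻ t in Ioi (0 : ℝ), ENNReal.ofReal (t ^ (p - 1)) *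
      ∫⁻ x in {x | ENNReal.ofReal t < F x}, G x ∂μ = ∫⁻ x, G x * F x ^ p ∂μ := by
  have hms : MeasurableSet {z : ℝ × X | ENNReal.ofReal z.1 < F z.2} :=
    measurableSet_lt (by fun_prop) (by fun_prop)
  have hst : ∀ t : ℝ, MeasurableSet {x | ENNReal.ofReal t < F x} := fun t =>
    measurableSet_lt measurable_const hF
  have hjm : Measurable (fun z : ℝ × X => {z : ℝ × X | ENNReal.ofReal z.1 < F z.2}.indicator
      (fun z => ENNReal.ofReal (z.1 ^ (p - 1)) * G z.2) z) := by
    refine Measurable.indicator ?_ hms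
    fun_prop
  have h1 : ∀ t : ℝ, ENNReal.ofReal (t ^ (p - 1)) * ∫⁻ x in {x | ENNReal.ofReal t < F x}, G x ∂μ
      = ∫⁻ x, {z : ℝ × X | ENNReal.ofReal z.1 < F z.2}.indicator
      (fun z => ENNReal.ofReal (z.1 ^ (p - 1)) * G z.2) (t, x) ∂μ := by
    intro t
    rw [← lintegral_indicator (hst t), ← lintegral_const_mul _ (hG.indicator (hst t))]
    refine lintegral_congr fun x => ?_
    by_cases h : ENNReal.ofReal t < F x <;> simp [indicator, h]
  simp_rw [h1]
  rw [lintegral_lintegral_swap hjm.aemeasurable, ← lintegral_const_mul _ hjm.lintegral_prod_left']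
  refine lintegral_congr fun x => ?_
  rw [← layer_pt p hp (F x), mul_left_comm]
  congr 1
  rw [← lintegral_const_mul]
  · refine lintegral_congr fun t => ?_
    by_cases h : ENNReal.ofReal t < F x <;> simp [indicator, h, mul_comm]
  · refine Measurable.indicator (by fun_prop) (measurableSet_lt (by fun_prop) measurable_const)

lemma marcin {X : Type*} [MeasurableSpace X] (μ : Measure X) [SFinite μ] (p : ℝ) (hp : 1 < p)
    (F g : X → ℝ≥0∞) (hF : Measurable F) (hg : Measurable g) (A : ℝ≥0∞) (hA : A ≠ ⊤)
    (h : ∀ t : ℝ, 0 < t → ENNReal.ofReal t * μ {x | ENNReal.ofReal t < F x} ≤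
      A * ∫⁻ x in {x | ENNReal.ofReal t < 2 * g x}, g x ∂μ) :
    ∫⁻ x, F x ^ p ∂μ ≤ A * ENNReal.ofReal (p / (p - 1) * 2 ^ (p - 1)) * ∫⁻ x, g x ^ p ∂μ := by
  have hp0 : 0 < p := by linarith
  have hp1 : 0 < p - 1 := by linarith
  have e1 := layer_meas μ p hp0 F (fun _ => 1) hF measurable_const
  have e2 := layer_meas μ (p - 1) hp1 (fun x => 2 * g x) g (hg.const_mul 2) hg
  simp only [one_mul, lintegral_const, Measure.restrict_apply MeasurableSet.univ, univ_inter] at e1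
  have e3 : ∀ x, g x * (2 * g x) ^ (p - 1) = ENNReal.ofReal (2 ^ (p - 1)) * g x ^ p := by
    intro x
    rw [ENNReal.mul_rpow_of_nonneg _ _ hp1.le, ← ENNReal.ofReal_rpow_of_pos two_pos,
      ENNReal.ofReal_ofNat]
    have : g x ^ p = g x * g x ^ (p - 1) := by
      conv_rhs => rw [← ENNReal.rpow_one (g x), ← ENNReal.rpow_mul, one_mul]
      rw [← ENNReal.rpow_add_of_nonneg _ _ zero_le_one hp1.le]; congr 1; ring
    rw [this]; ring
  simp_rw [e3] at e2
  rw [lintegral_const_mul _ (hg.pow_const p)] at e2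
  have e4 : ENNReal.ofReal (p / (p - 1) * 2 ^ (p - 1)) * ∫⁻ x, g x ^ p ∂μ
      = ENNReal.ofReal p * ∫⁻ t in Ioi (0 : ℝ), ENNReal.ofReal (t ^ (p - 1 - 1)) *
      ∫⁻ x in {x | ENNReal.ofReal t < 2 * g x}, g x ∂μ := by
    rw [ENNReal.ofReal_mul (by positivity), mul_assoc, ← e2, ← mul_assoc,
      ← ENNReal.ofReal_mul (by positivity), div_mul_cancel₀ _ hp1.ne']
  rw [← e1, mul_assoc, e4, mul_left_comm]
  gcongr
  rw [← lintegral_const_mul' _ _ hA]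
  refine setLIntegral_mono' measurableSet_Ioi fun t ht => ?_
  have ht' : (0 : ℝ) < t := ht
  have e5 : t ^ (p - 1) = t ^ (p - 1 - 1) * t := by
    rw [Real.rpow_sub_one ht'.ne' (p - 1), div_mul_cancel₀ _ ht'.ne']
  rw [e5, ENNReal.ofReal_mul (by positivity), mul_assoc, mul_left_comm A]
  exact mul_le_mul_right (h t ht') _

def cM {X : Type*} [PseudoMetricSpace X] [MeasurableSpace X] (μ : Measure X) (β : ℝ)
    (g : X → ℝ≥0∞) (x : X) : ℝ≥0∞ :=
  ⨆ r : {r : ℚ // 0 < r}, μ (Metric.ball x (r : ℚ)) ^ (-β) *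
    ∫⁻ y in Metric.ball x (r : ℚ), g y ∂μ

lemma measurable_ball_meas {X : Type*} [PseudoMetricSpace X] [SecondCountableTopology X]
    [MeasurableSpace X] [OpensMeasurableSpace X] (μ : Measure X) [SFinite μ] (r : ℝ) :
    Measurable fun x => μ (Metric.ball x r) := by
  have h : MeasurableSet {z : X × X | dist z.2 z.1 < r} :=
    (isOpen_lt (by fun_prop) (by fun_prop)).measurableSet
  exact measurable_measure_prodMk_left (ν := μ) h

lemma cM_measurable {X : Type*} [PseudoMetricSpace X] [SecondCountableTopology X]
    [MeasurableSpace X] [OpensMeasurableSpace X] (μ : Measure X) [SFinite μ] (β : ℝ)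
    (g : X → ℝ≥0∞) : Measurable (cM μ β g) := by
  unfold cM
  refine Measurable.iSup fun r => ?_
  refine ((measurable_ball_meas μ _).pow_const _).mul ?_
  have : ∀ x, ∫⁻ y in Metric.ball x (r : ℚ), g y ∂μ
      = μ.withDensity g (Metric.ball x (r : ℚ)) := fun x =>
    (withDensity_apply _ Metric.isOpen_ball.measurableSet).symm
  simp_rw [this]
  exact measurable_ball_meas _ _

lemma cM_strong (X : Type*) [MetricSpace X] [SecondCountableTopology X]
    [HasBesicovitchCovering X] [MeasurableSpace X] [OpensMeasurableSpace X] (p : ℝ) (hp : 1 < p) :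
    ∃ C : ℝ≥0∞, C ≠ ⊤ ∧ ∀ (μ : Measure X) [SFinite μ],
      (∀ x r, 0 < r → μ (Metric.ball x r) ≠ 0) → (∀ x r, μ (Metric.ball x r) ≠ ⊤) →
      ∀ g : X → ℝ≥0∞, Measurable g → ∫⁻ x, cM μ 1 g x ^ p ∂μ ≤ C * ∫⁻ x, g x ^ p ∂μ := by
  obtain ⟨N, hN⟩ := weak_besicovitch X
  have hA : (2 * N : ℝ≥0∞) ≠ ⊤ := ENNReal.mul_ne_top (by simp) (by simp)
  refine ⟨2 * N * ENNReal.ofReal (p / (p - 1) * 2 ^ (p - 1)),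
    ENNReal.mul_ne_top hA ENNReal.ofReal_ne_top, ?_⟩
  intro μ _ h0 hT g hg
  refine marcin μ p hp _ g (cM_measurable μ 1 g) hg _ hA ?_
  intro t ht
  have hms : MeasurableSet {x | ENNReal.ofReal t < 2 * g x} :=
    measurableSet_lt measurable_const (hg.const_mul 2)
  set ν := μ.withDensity ({x | ENNReal.ofReal t < 2 * g x}.indicator g) with hν
  set c := ENNReal.ofReal (t / 2) with hc
  have htc : ENNReal.ofReal t = 2 * c := by
    rw [hc, ← ENNReal.ofReal_ofNat, ← ENNReal.ofReal_mul (by norm_num)]; congr 1; ring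
  have hw := hN μ ν c
  have hνu : ν univ = ∫⁻ x in {x | ENNReal.ofReal t < 2 * g x}, g x ∂μ := by
    rw [hν, withDensity_apply _ MeasurableSet.univ, Measure.restrict_univ, lintegral_indicator hms]
  rw [hνu] at hw
  have hsub : {x | ENNReal.ofReal t < cM μ 1 g x} ⊆
      {x | ∃ r : ℚ, 0 < r ∧ c * μ (Metric.ball x r) < ν (Metric.ball x r)} := by
    intro x hx
    have hx0 : ENNReal.ofReal t < cM μ 1 g x := hx
    unfold cM at hx0
    obtain ⟨⟨r, hr⟩, hx⟩ := lt_iSup_iff.1 hx0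
    refine ⟨r, hr, ?_⟩
    have hr' : (0 : ℝ) < r := by exact_mod_cast hr
    simp only [ENNReal.rpow_neg_one] at hx
    rw [mul_comm, ← div_eq_mul_inv, ENNReal.lt_div_iff_mul_lt (Or.inl (h0 _ _ hr'))
      (Or.inl (hT _ _))] at hx
    have hfin : c * μ (Metric.ball x r) ≠ ⊤ := ENNReal.mul_ne_top ENNReal.ofReal_ne_top (hT _ _)
    have h2 : ∫⁻ y in Metric.ball x r, g y ∂μ ≤ ν (Metric.ball x r) + c * μ (Metric.ball x r) := by
      rw [hν, withDensity_apply _ Metric.isOpen_ball.measurableSet, ← setLIntegral_const,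
        ← lintegral_add_right _ measurable_const]
      refine lintegral_mono fun y => ?_
      by_cases hy : ENNReal.ofReal t < 2 * g y
      · simp [indicator, hy]
      · have : g y ≤ c := by
          rw [htc] at hy
          exact (ENNReal.mul_le_mul_iff_right (by simp) (by simp)).1 (not_lt.1 hy)
        simpa [indicator, hy] using this
    have h3 := hx.trans_le h2
    rw [htc, two_mul, add_mul] at h3
    exact (ENNReal.add_lt_add_iff_right hfin).1 h3
  calc ENNReal.ofReal t * μ {x | ENNReal.ofReal t < cM μ 1 g x}
      ≤ 2 * (c * μ {x | ∃ r : ℚ, 0 < r ∧ c * μ (Metric.ball x r) < ν (Metric.ball x r)}) := by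
        rw [htc, mul_assoc]; rw [htc] at hsub; gcongr
    _ ≤ 2 * (N * ∫⁻ x in {x | ENNReal.ofReal t < 2 * g x}, g x ∂μ) := by gcongr
    _ = _ := by rw [mul_assoc]

lemma cM_frac (X : Type*) [MetricSpace X] [SecondCountableTopology X]
    [HasBesicovitchCovering X] [MeasurableSpace X] [OpensMeasurableSpace X] (p q β : ℝ)
    (hp : 1 < p) (hpq : p ≤ q) (hβ : β = 1 - 1 / p + 1 / q) :
    ∃ C : ℝ≥0∞, C ≠ ⊤ ∧ ∀ (μ : Measure X) [SFinite μ],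
      (∀ x r, 0 < r → μ (Metric.ball x r) ≠ 0) → (∀ x r, μ (Metric.ball x r) ≠ ⊤) →
      ∀ g : X → ℝ≥0∞, Measurable g →
        ∫⁻ x, cM μ β g x ^ q ∂μ ≤ C * (∫⁻ x, g x ^ p ∂μ) ^ (q / p) := by
  obtain ⟨C, hC, hM⟩ := cM_strong X p hp
  refine ⟨C, hC, ?_⟩
  intro μ _ h0 hT g hg
  have hp0 : 0 < p := by linarith
  have hq0 : 0 < q := by linarith
  have hpq1 : p / q ≤ 1 := (div_le_one hq0).2 hpq
  set L := ∫⁻ x, g x ^ p ∂μ with hL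
  have key : ∀ x, cM μ β g x ≤ cM μ 1 g x ^ (p / q) * L ^ (1 / p * (1 - p / q)) := by
    intro x
    refine iSup_le fun r => ?_
    have hr' : (0 : ℝ) < (r : ℚ) := by exact_mod_cast r.2
    set m := μ (Metric.ball x (r : ℚ)) with hm
    have hm0 : m ≠ 0 := h0 _ _ hr'
    have hmT : m ≠ ⊤ := hT _ _
    set I := ∫⁻ y in Metric.ball x (r : ℚ), g y ∂μ with hI
    have hle : m⁻¹ * I ≤ cM μ 1 g x := by
      have := le_iSup (fun r : {r : ℚ // 0 < r} => μ (Metric.ball x (r : ℚ)) ^ (-1 : ℝ) *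
        ∫⁻ y in Metric.ball x (r : ℚ), g y ∂μ) r
      rwa [ENNReal.rpow_neg_one] at this
    have hold : I ≤ L ^ (1 / p) * m ^ (1 - 1 / p) := by
      have := ENNReal.lintegral_mul_le_Lp_mul_Lq (μ.restrict (Metric.ball x (r : ℚ)))
        (Real.HolderConjugate.conjExponent hp) hg.aemeasurable
        (aemeasurable_const (b := (1 : ℝ≥0∞)))
      simp only [Pi.mul_apply, mul_one, ENNReal.one_rpow, lintegral_const,
        Measure.restrict_apply MeasurableSet.univ, univ_inter, one_mul] at this
      refine this.trans ?_
      have e : 1 / Real.conjExponent p = 1 - 1 / p := by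
        unfold Real.conjExponent; field_simp
      rw [e]
      gcongr
      exact setLIntegral_le_lintegral _ _
    have hmI : m⁻¹ * I ≤ L ^ (1 / p) * m ^ (- (1 / p)) := by
      calc m⁻¹ * I ≤ m⁻¹ * (L ^ (1 / p) * m ^ (1 - 1 / p)) := by gcongr
        _ = L ^ (1 / p) * (m ^ (-1 : ℝ) * m ^ (1 - 1 / p)) := by
          rw [ENNReal.rpow_neg_one]; ring
        _ = _ := by rw [← ENNReal.rpow_add _ _ hm0 hmT]; congr 2; ring
    calc m ^ (-β) * I = m ^ (1 - β) * (m⁻¹ * I) := by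
          rw [← mul_assoc, ← ENNReal.rpow_neg_one m, ← ENNReal.rpow_add _ _ hm0 hmT]
          congr 2; ring
      _ = m ^ (1 - β) * ((m⁻¹ * I) ^ (p / q) * (m⁻¹ * I) ^ (1 - p / q)) := by
          rw [← ENNReal.rpow_add_of_nonneg _ _ (by positivity) (by linarith)]
          simp
      _ ≤ m ^ (1 - β) * (cM μ 1 g x ^ (p / q) *
            (L ^ (1 / p) * m ^ (- (1 / p))) ^ (1 - p / q)) := by
          gcongr
      _ = cM μ 1 g x ^ (p / q) * L ^ (1 / p * (1 - p / q)) *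
            (m ^ (1 - β) * m ^ (-(1 / p) * (1 - p / q))) := by
          rw [ENNReal.mul_rpow_of_nonneg _ _ (by linarith), ← ENNReal.rpow_mul,
            ← ENNReal.rpow_mul]
          ring
      _ = _ := by
          rw [← ENNReal.rpow_add _ _ hm0 hmT]
          have : 1 - β + -(1 / p) * (1 - p / q) = 0 := by rw [hβ]; field_simp; ring
          rw [this, ENNReal.rpow_zero, mul_one]
  calc ∫⁻ x, cM μ β g x ^ q ∂μ
      ≤ ∫⁻ x, cM μ 1 g x ^ p * L ^ (q / p - 1) ∂μ := by
        refine lintegral_mono fun x => ?_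
        refine (ENNReal.rpow_le_rpow (key x) hq0.le).trans_eq ?_
        rw [ENNReal.mul_rpow_of_nonneg _ _ hq0.le, ← ENNReal.rpow_mul, ← ENNReal.rpow_mul]
        congr 2 <;> field_simp
    _ = (∫⁻ x, cM μ 1 g x ^ p ∂μ) * L ^ (q / p - 1) :=
        lintegral_mul_const _ ((cM_measurable μ 1 g).pow_const p)
    _ ≤ (C * L) * L ^ (q / p - 1) := by gcongr; exact hM μ h0 hT g hg
    _ = C * L ^ (q / p) := by
        have : 0 ≤ q / p - 1 := by rw [sub_nonneg, one_le_div hp0]; exact hpq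
        rw [mul_assoc]
        conv_lhs => rw [← ENNReal.rpow_one L, ← ENNReal.rpow_mul, one_mul]
        rw [← ENNReal.rpow_add_of_nonneg _ _ zero_le_one this]
        congr 2; ring

lemma alg_pt (v u u3 s3 I K H D : ℝ≥0∞) (β s e : ℝ) (hs : 0 < s) (hβ : β * s = e) (he : 0 < e)
    (hv0 : v ≠ 0) (hvT : v ≠ ⊤) (hu0 : u ≠ 0) (huT : u ≠ ⊤) (hu3 : u ≤ u3)
    (hs0 : s3 ≠ 0) (hsT : s3 ≠ ⊤) (hD0 : D ≠ 0) (hDT : D ≠ ⊤)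
    (h1 : (D * v)⁻¹ * u3 * ((D * v)⁻¹ * s3) ^ e ≤ K)
    (h2 : u⁻¹ * ((s3 ^ (-β) * I) ^ s * v) ≤ H) :
    (v ^ (-β) * I) ^ s ≤ D ^ (1 + e) * (K * H) := by
  have hX : ∀ y : ℝ≥0∞, (y ^ (-β) * I) ^ s = y ^ (-e) * I ^ s := by
    intro y
    rw [ENNReal.mul_rpow_of_nonneg _ _ hs.le, ← ENNReal.rpow_mul, ← hβ, neg_mul]
  have hDv0 : D * v ≠ 0 := mul_ne_zero hD0 hv0
  have hDvT : D * v ≠ ⊤ := ENNReal.mul_ne_top hDT hvT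
  rw [hX] at h2 ⊢
  have h3 := mul_le_mul' h1 h2
  have e1 : (D * v)⁻¹ * u3 * ((D * v)⁻¹ * s3) ^ e * (u⁻¹ * (s3 ^ (-e) * I ^ s * v))
      = (u3 * u⁻¹) * (s3 ^ e * s3 ^ (-e)) * (D ^ (-(1 + e))) * (v ^ (-e) * I ^ s) := by
    rw [ENNReal.mul_rpow_of_nonneg _ _ he.le, ENNReal.inv_rpow, ← ENNReal.rpow_neg,
      ← ENNReal.rpow_neg_one (D * v)]
    have a1 : (D * v) ^ (-1 : ℝ) * (D * v) ^ (-e) = D ^ (-(1 + e)) * v ^ (-(1 + e)) := by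
      rw [← ENNReal.rpow_add _ _ hDv0 hDvT, ENNReal.mul_rpow_of_ne_top hDT hvT]
      congr 2 <;> ring
    have a2 : v ^ (-(1 + e)) * v = v ^ (-e) := by
      conv_lhs => enter [2]; rw [← ENNReal.rpow_one v]
      rw [← ENNReal.rpow_add _ _ hv0 hvT]; congr 1; ring
    calc _ = ((D * v) ^ (-1 : ℝ) * (D * v) ^ (-e)) * v * (u3 * u⁻¹) * (s3 ^ e * s3 ^ (-e)) * I ^ s := by
          ring
      _ = _ := by rw [a1, ← a2]; ring
  have e2 : s3 ^ e * s3 ^ (-e) = 1 := by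
    rw [← ENNReal.rpow_add _ _ hs0 hsT, add_neg_cancel, ENNReal.rpow_zero]
  have e3 : 1 ≤ u3 * u⁻¹ := by
    rw [← ENNReal.mul_inv_cancel hu0 huT]; gcongr
  have e4 : D ^ (1 + e) * D ^ (-(1 + e)) = 1 := by
    rw [← ENNReal.rpow_add _ _ hD0 hDT, add_neg_cancel, ENNReal.rpow_zero]
  rw [e1, e2, mul_one] at h3
  calc v ^ (-e) * I ^ s = D ^ (1 + e) * (1 * D ^ (-(1 + e)) * (v ^ (-e) * I ^ s)) := by
        rw [one_mul, ← mul_assoc, e4, one_mul]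
    _ ≤ D ^ (1 + e) * (u3 * u⁻¹ * D ^ (-(1 + e)) * (v ^ (-e) * I ^ s)) := by gcongr
    _ ≤ _ := by gcongr

lemma nondeg (n : ℕ) (q p' e : ℝ) (hq : 0 < q) (hp' : 0 < p') (he : 0 < e)
    (W : (Fin n → ℝ) → ℝ≥0∞) (hW : Measurable W) (hWT : ∀ x, W x ≠ ⊤)
    (K : ℝ≥0∞) (hK : K ≠ ⊤)
    (hA : ∀ (x : Fin n → ℝ) (r : ℝ), 0 < r →
      (volume (Metric.ball x r))⁻¹ * (volume.withDensity fun y => W y ^ q) (Metric.ball x r) *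
      ((volume (Metric.ball x r))⁻¹ *
        (volume.withDensity fun y => W y ^ (-p')) (Metric.ball x r)) ^ e ≤ K)
    (hz : ¬ W =ᵐ[volume] 0) :
    (∀ᵐ x ∂volume, W x ≠ 0) ∧
    (∀ x r, 0 < r → (volume.withDensity fun y => W y ^ q) (Metric.ball x r) ≠ 0) ∧
    (∀ x r, (volume.withDensity fun y => W y ^ q) (Metric.ball x r) ≠ ⊤) ∧
    (∀ x r, 0 < r → (volume.withDensity fun y => W y ^ (-p')) (Metric.ball x r) ≠ 0) ∧
    (∀ x r, (volume.withDensity fun y => W y ^ (-p')) (Metric.ball x r) ≠ ⊤) := by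
  set μu := (volume : Measure (Fin n → ℝ)).withDensity fun y => W y ^ q with hμu
  set μσ := (volume : Measure (Fin n → ℝ)).withDensity fun y => W y ^ (-p') with hμσ
  have vT : ∀ (x : Fin n → ℝ) r, (volume (Metric.ball x r)) ≠ ⊤ := fun x r => measure_ball_lt_top.ne
  have v0 : ∀ (x : Fin n → ℝ) r, 0 < r → (volume (Metric.ball x r)) ≠ 0 := fun x r hr =>
    (Metric.measure_ball_pos _ _ hr).ne'
  have hu : μu univ ≠ 0 := by
    intro h
    rw [hμu, withDensity_apply _ MeasurableSet.univ, Measure.restrict_univ,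
      lintegral_eq_zero_iff (hW.pow_const q)] at h
    apply hz
    filter_upwards [h] with x hx
    simpa [ENNReal.rpow_eq_zero_iff, hq, hq.not_gt] using hx
  have hex : ∀ x, ∃ k : ℕ, μu (Metric.ball x k) ≠ 0 := by
    intro x
    by_contra! hcon
    apply hu
    rw [← Metric.iUnion_ball_nat x]
    exact measure_iUnion_null hcon
  have hσT : ∀ x r, μσ (Metric.ball x r) ≠ ⊤ := by
    intro x r
    obtain ⟨k, hk⟩ := hex x
    set R : ℝ := max (k : ℝ) r + 1
    have hR : 0 < R := by have : (0 : ℝ) ≤ k := by positivity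
                          have := this.trans (le_max_left (k : ℝ) r); positivity
    have hkR : (k : ℝ) ≤ R := (le_max_left (k : ℝ) r).trans (le_add_of_nonneg_right zero_le_one)
    have hrR : r ≤ R := (le_max_right (k : ℝ) r).trans (le_add_of_nonneg_right zero_le_one)
    have h1 : μu (Metric.ball x R) ≠ 0 := fun h =>
      hk (measure_mono_null (Metric.ball_subset_ball hkR) h)
    have h2 := ne_top_of_le_ne_top hK (hA x R hR)
    intro h3
    have h4 : μσ (Metric.ball x R) = ⊤ := top_le_iff.1 (h3 ▸ measure_mono (Metric.ball_subset_ball hrR))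
    apply h2
    rw [h4, ENNReal.mul_top (ENNReal.inv_ne_zero.2 (vT _ _)), ENNReal.top_rpow_of_pos he,
      ENNReal.mul_top]
    exact mul_ne_zero (ENNReal.inv_ne_zero.2 (vT _ _)) h1
  have hW0 : ∀ᵐ x ∂(volume : Measure (Fin n → ℝ)), W x ≠ 0 := by
    have h1 : ∀ k : ℕ, volume ({x | W x = 0} ∩ Metric.ball 0 k) = 0 := by
      intro k
      have h2 := hσT 0 k
      rw [hμσ, withDensity_apply _ Metric.isOpen_ball.measurableSet] at h2
      have h3 := ae_lt_top (hW.pow_const (-p')) h2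
      have h4 : ∀ᵐ x ∂volume.restrict (Metric.ball (0 : Fin n → ℝ) k), W x ≠ 0 := by
        filter_upwards [h3] with x hx h0
        simp [h0, ENNReal.zero_rpow_of_neg (neg_lt_zero.2 hp')] at hx
      rw [ae_iff] at h4
      rw [Measure.restrict_apply' Metric.isOpen_ball.measurableSet] at h4
      simpa using h4
    have h5 := measure_iUnion_null h1
    rw [← inter_iUnion, Metric.iUnion_ball_nat, inter_univ] at h5
    rw [ae_iff]; simpa using h5
  have ac1 : volume ≪ μu := withDensity_absolutelyContinuous' (hW.pow_const q).aemeasurable (by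
    filter_upwards [hW0] with x hx
    simp [ENNReal.rpow_eq_zero_iff, hx, hWT x])
  have ac2 : volume ≪ μσ := withDensity_absolutelyContinuous' (hW.pow_const (-p')).aemeasurable (by
    filter_upwards [hW0] with x hx
    simp [ENNReal.rpow_eq_zero_iff, hx, hWT x])
  have hu0 : ∀ x r, 0 < r → μu (Metric.ball x r) ≠ 0 := fun x r hr h => v0 x r hr (ac1 h)
  have hσ0 : ∀ x r, 0 < r → μσ (Metric.ball x r) ≠ 0 := fun x r hr h => v0 x r hr (ac2 h)
  refine ⟨hW0, hu0, ?_, hσ0, hσT⟩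
  intro x r
  rcases le_or_gt r 0 with hr | hr
  · rw [Metric.ball_eq_empty.2 hr]; simp
  have h2 := ne_top_of_le_ne_top hK (hA x r hr)
  intro h3
  apply h2
  rw [h3, ENNReal.mul_top (ENNReal.inv_ne_zero.2 (vT _ _)), ENNReal.top_mul]
  have h6 : (volume (Metric.ball x r))⁻¹ * μσ (Metric.ball x r) ≠ 0 :=
    mul_ne_zero (ENNReal.inv_ne_zero.2 (vT _ _)) (hσ0 x r hr)
  rw [Ne, ENNReal.rpow_eq_zero_iff]
  push Not
  exact ⟨fun h => absurd h h6, fun _ => he.le⟩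

lemma core (n : ℕ) (p q β p' : ℝ) (hp : 1 < p) (hpq : p ≤ q)
    (hβ : β = 1 - 1 / p + 1 / q) (hp' : p' = p / (p - 1)) :
    ∃ C : ℝ≥0∞, C ≠ ⊤ ∧ ∀ W F : (Fin n → ℝ) → ℝ≥0∞, Measurable W → Measurable F →
      (∀ x, W x ≠ ⊤) → ∀ K : ℝ≥0∞, K ≠ ⊤ →
      (∀ (x : Fin n → ℝ) (r : ℝ), 0 < r →
        (volume (Metric.ball x r))⁻¹ * (volume.withDensity fun y => W y ^ q) (Metric.ball x r) *
        ((volume (Metric.ball x r))⁻¹ *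
          (volume.withDensity fun y => W y ^ (-p')) (Metric.ball x r)) ^ (q / p') ≤ K) →
      ∫⁻ x, (W x * cM volume β F x) ^ q ≤
        C * K ^ (p' * β) * (∫⁻ x, (W x * F x) ^ p) ^ (q / p) := by
  have hp0 : 0 < p := by linarith
  have hp1 : 0 < p - 1 := by linarith
  have hq0 : 0 < q := by linarith
  have hp'0 : 0 < p' := by rw [hp']; positivity
  set e := q / p' with he
  have he0 : 0 < e := by positivity
  set m := p' * β with hm
  have hm1 : m = 1 + p' / q := by
    rw [hm, hβ, hp']; field_simp
  have hm' : 1 < m := by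
    have : 0 < p' / q := by positivity
    linarith
  have hm0 : 0 < m := by linarith
  set s := q / m with hs
  have hs0 : 0 < s := by positivity
  have hβs : β * s = e := by
    have : β ≠ 0 := by rintro rfl; simp [hm] at hm0
    rw [hs, hm, he]; field_simp
  have hsm : s * m = q := by rw [hs]; field_simp
  obtain ⟨C1, hC1, hM1⟩ := cM_strong (Fin n → ℝ) m hm'
  obtain ⟨C2, hC2, hM2⟩ := cM_frac (Fin n → ℝ) p q β hp hpq hβ
  set D : ℝ≥0∞ := ENNReal.ofReal (3 ^ n) with hD
  have hD0 : D ≠ 0 := by rw [hD]; simp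
  have hDT : D ≠ ⊤ := ENNReal.ofReal_ne_top
  refine ⟨(D ^ (1 + e)) ^ m * (C1 * C2), ENNReal.mul_ne_top ?_ (ENNReal.mul_ne_top hC1 hC2), ?_⟩
  · exact ENNReal.rpow_ne_top_of_nonneg hm0.le (ENNReal.rpow_ne_top_of_nonneg (by positivity) hDT)
  intro W F hW hF hWT K hK hA
  by_cases hz : W =ᵐ[volume] 0
  · have : ∫⁻ x, (W x * cM volume β F x) ^ q = 0 := by
      have hm2 : Measurable fun x => (W x * cM volume β F x) ^ q :=
        (hW.mul (cM_measurable _ _ _)).pow_const q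
      rw [lintegral_eq_zero_iff hm2]
      filter_upwards [hz] with x hx
      simp [hx, hq0]
    rw [this]; exact zero_le
  obtain ⟨hW0, hu0, huT, hσ0, hσT⟩ := nondeg n q p' e hq0 hp'0 he0 W hW hWT K hK hA hz
  set μu := (volume : Measure (Fin n → ℝ)).withDensity fun y => W y ^ q with hμu
  set μσ := (volume : Measure (Fin n → ℝ)).withDensity fun y => W y ^ (-p') with hμσ
  have vT : ∀ (x : Fin n → ℝ) r, (volume (Metric.ball x r)) ≠ ⊤ := fun x r => measure_ball_lt_top.ne
  have v0 : ∀ (x : Fin n → ℝ) r, 0 < r → (volume (Metric.ball x r)) ≠ 0 := fun x r hr =>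
    (Metric.measure_ball_pos _ _ hr).ne'
  have hWu : Measurable fun y => W y ^ q := hW.pow_const q
  have hWσ : Measurable fun y => W y ^ (-p') := hW.pow_const (-p')
  set G : (Fin n → ℝ) → ℝ≥0∞ := fun y => F y * W y ^ p' with hG
  have hGm : Measurable G := hF.mul (hW.pow_const _)
  set N := cM μσ β G with hN
  have hNm : Measurable N := cM_measurable _ _ _
  set P : (Fin n → ℝ) → ℝ≥0∞ := fun y => N y ^ s * W y ^ (-q) with hP
  have hPm : Measurable P := (hNm.pow_const _).mul (hW.pow_const _)
  set H := cM μu 1 P with hH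
  have iG : ∀ S, MeasurableSet S → ∫⁻ y in S, G y ∂μσ = ∫⁻ y in S, F y := by
    intro S hS
    rw [hμσ, setLIntegral_withDensity_eq_setLIntegral_mul _ hWσ hGm hS]
    refine lintegral_congr_ae (ae_restrict_of_ae ?_)
    filter_upwards [hW0] with y hy
    simp only [Pi.mul_apply, hG]
    rw [mul_left_comm, ← ENNReal.rpow_add _ _ hy (hWT y), neg_add_cancel, ENNReal.rpow_zero, mul_one]
  have iP : ∀ S, MeasurableSet S → ∫⁻ y in S, P y ∂μu = ∫⁻ y in S, N y ^ s := by
    intro S hS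
    rw [hμu, setLIntegral_withDensity_eq_setLIntegral_mul _ hWu hPm hS]
    refine lintegral_congr_ae (ae_restrict_of_ae ?_)
    filter_upwards [hW0] with y hy
    simp only [Pi.mul_apply, hP]
    rw [mul_left_comm, ← ENNReal.rpow_add _ _ hy (hWT y), add_neg_cancel, ENNReal.rpow_zero, mul_one]
  have iGp : ∫⁻ y, G y ^ p ∂μσ = ∫⁻ y, (W y * F y) ^ p := by
    rw [hμσ, lintegral_withDensity_eq_lintegral_mul _ hWσ (hGm.pow_const p)]
    refine lintegral_congr_ae ?_
    filter_upwards [hW0] with y hy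
    simp only [Pi.mul_apply, hG]
    rw [ENNReal.mul_rpow_of_nonneg _ _ hp0.le, ENNReal.mul_rpow_of_nonneg _ _ hp0.le,
      ← ENNReal.rpow_mul, mul_left_comm, ← ENNReal.rpow_add _ _ hy (hWT y), mul_comm]
    congr 2
    rw [hp']; field_simp; ring
  have iPm : ∫⁻ y, P y ^ m ∂μu = ∫⁻ y, N y ^ q ∂μσ := by
    rw [hμσ, lintegral_withDensity_eq_lintegral_mul _ hWσ (hNm.pow_const q),
      hμu, lintegral_withDensity_eq_lintegral_mul _ hWu (hPm.pow_const m)]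
    refine lintegral_congr_ae ?_
    filter_upwards [hW0] with y hy
    simp only [Pi.mul_apply, hP]
    rw [ENNReal.mul_rpow_of_nonneg _ _ hm0.le, ← ENNReal.rpow_mul, ← ENNReal.rpow_mul, hsm,
      mul_left_comm, ← ENNReal.rpow_add _ _ hy (hWT y), mul_comm]
    congr 2
    rw [hm1]; field_simp; ring
  have key : ∀ x, cM volume β F x ^ q ≤ (D ^ (1 + e)) ^ m * (K ^ m * H x ^ m) := by
    intro x
    have : cM volume β F x ≤ (D ^ (1 + e) * (K * H x)) ^ (1 / s) := by
      refine iSup_le fun r => ?_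
      have hr : (0 : ℝ) < (r : ℚ) := by exact_mod_cast r.2
      rw [one_div, ENNReal.le_rpow_inv_iff hs0]
      set B := Metric.ball x (r : ℚ) with hB
      set B3 := Metric.ball x (3 * ((r : ℚ) : ℝ)) with hB3
      have hv3 : volume B3 = D * volume B := by
        rw [hB3, hB, Real.volume_pi_ball _ hr, Real.volume_pi_ball _ (by positivity), hD,
          ← ENNReal.ofReal_mul (by positivity), Fintype.card_fin, ← mul_pow]
        congr 2; ring
      have hBB3 : B ⊆ B3 := Metric.ball_subset_ball (by linarith)
      refine alg_pt (volume B) (μu B) (μu B3) (μσ B3) (∫⁻ y in B, F y) K (H x) D β s e hs0 hβs he0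
        (v0 _ _ hr) (vT _ _) (hu0 _ _ hr) (huT _ _) (measure_mono hBB3) (hσ0 _ _ (by positivity))
        (hσT _ _) hD0 hDT ?_ ?_
      · rw [← hv3]; exact hA x (3 * ((r : ℚ) : ℝ)) (by positivity)
      · have h1 : (μσ B3 ^ (-β) * ∫⁻ y in B, F y) ^ s * volume B ≤ ∫⁻ y in B, P y ∂μu := by
          rw [iP _ Metric.isOpen_ball.measurableSet, ← setLIntegral_const]
          refine setLIntegral_mono' Metric.isOpen_ball.measurableSet fun y hy => ?_
          have hβ0 : 0 < β := by by_contra hc; have := mul_nonpos_of_nonneg_of_nonpos hp'0.le (not_lt.1 hc); linarith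
          gcongr
          have hy' : dist y x < ((r : ℚ) : ℝ) := hy
          have s1 : B ⊆ Metric.ball y (2 * ((r : ℚ) : ℝ)) :=
            Metric.ball_subset_ball' (by rw [dist_comm]; linarith)
          have s2 : Metric.ball y (2 * ((r : ℚ) : ℝ)) ⊆ B3 :=
            Metric.ball_subset_ball' (by linarith)
          have h2 := le_iSup (fun r : {r : ℚ // 0 < r} => μσ (Metric.ball y (r : ℚ)) ^ (-β) *
            ∫⁻ z in Metric.ball y (r : ℚ), G z ∂μσ) ⟨2 * r, by have := r.2; positivity⟩
          refine le_trans ?_ h2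
          simp only [Rat.cast_mul, Rat.cast_ofNat]
          rw [iG _ Metric.isOpen_ball.measurableSet]
          refine mul_le_mul' ?_ (lintegral_mono_set s1)
          rw [ENNReal.rpow_neg, ENNReal.rpow_neg, ENNReal.inv_le_inv]
          exact ENNReal.rpow_le_rpow (measure_mono s2) hβ0.le
        have h3 := le_iSup (fun r : {r : ℚ // 0 < r} => μu (Metric.ball x (r : ℚ)) ^ (-1 : ℝ) *
            ∫⁻ z in Metric.ball x (r : ℚ), P z ∂μu) r
        refine le_trans ?_ h3
        simp only [ENNReal.rpow_neg_one]
        exact mul_le_mul_right h1 _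
    refine (ENNReal.rpow_le_rpow this hq0.le).trans_eq ?_
    have : 1 / s * q = m := by rw [hs]; field_simp
    rw [← ENNReal.rpow_mul, this, ENNReal.mul_rpow_of_nonneg _ _ hm0.le,
      ENNReal.mul_rpow_of_nonneg _ _ hm0.le]
  calc ∫⁻ x, (W x * cM volume β F x) ^ q
      = ∫⁻ x, cM volume β F x ^ q ∂μu := by
        rw [hμu, lintegral_withDensity_eq_lintegral_mul _ hWu ((cM_measurable _ _ _).pow_const q)]
        refine lintegral_congr fun x => ?_
        simp only [Pi.mul_apply]
        rw [ENNReal.mul_rpow_of_nonneg _ _ hq0.le]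
    _ ≤ ∫⁻ x, (D ^ (1 + e)) ^ m * (K ^ m * H x ^ m) ∂μu := lintegral_mono key
    _ = (D ^ (1 + e)) ^ m * (K ^ m * ∫⁻ x, H x ^ m ∂μu) := by
        have hHm : Measurable H := cM_measurable _ _ _
        rw [lintegral_const_mul _ ((hHm.pow_const m).const_mul _),
          lintegral_const_mul _ (hHm.pow_const m)]
    _ ≤ (D ^ (1 + e)) ^ m * (K ^ m * (C1 * (C2 * (∫⁻ x, (W x * F x) ^ p) ^ (q / p)))) := by
        have h1 := hM1 μu hu0 huT P hPm
        have h2 := hM2 μσ hσ0 hσT G hGm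
        rw [iPm] at h1
        rw [iGp] at h2
        refine mul_le_mul_right (mul_le_mul_right (h1.trans (mul_le_mul_right h2 _)) _) _
    _ = _ := by ring

lemma preimage_cube (n : ℕ) (a : Euc n) (h : ℝ) (hh : 0 ≤ h) :
    (WithLp.toLp 2 : (Fin n → ℝ) → Euc n) ⁻¹' Cube a h =
      Metric.closedBall (fun i => a i + h / 2) (h / 2) := by
  ext y
  simp only [mem_preimage, Cube, mem_ofPred_eq, Metric.mem_closedBall]
  rw [dist_pi_le_iff (by positivity)]
  refine forall_congr' fun i => ?_
  rw [Real.dist_eq, abs_le]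
  constructor
  · rintro ⟨h1, h2⟩; constructor <;> linarith
  · rintro ⟨h1, h2⟩; constructor <;> linarith

lemma toLp_emb (n : ℕ) : MeasurableEmbedding (WithLp.toLp 2 : (Fin n → ℝ) → Euc n) :=
  (MeasurableEquiv.toLp 2 (Fin n → ℝ)).measurableEmbedding

lemma vol_cube (n : ℕ) (a : Euc n) (h : ℝ) (hh : 0 ≤ h) :
    volume (Cube a h) = ENNReal.ofReal (h ^ n) := by
  rw [← (PiLp.volume_preserving_toLp (Fin n)).measure_preimage_emb (toLp_emb n),
    preimage_cube n a h hh, Real.volume_pi_closedBall _ (by positivity), Fintype.card_fin]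
  congr 2; ring

lemma int_cube (n : ℕ) (a : Euc n) (h : ℝ) (hh : 0 ≤ h) (g : Euc n → ℝ≥0∞) :
    ∫⁻ x in Cube a h, g x =
      ∫⁻ y in Metric.closedBall (fun i => a i + h / 2) (h / 2), g (WithLp.toLp 2 y) := by
  rw [← (PiLp.volume_preserving_toLp (Fin n)).setLIntegral_comp_preimage_emb (toLp_emb n),
    preimage_cube n a h hh]

lemma int_all (n : ℕ) (g : Euc n → ℝ≥0∞) :
    ∫⁻ x, g x = ∫⁻ y : Fin n → ℝ, g (WithLp.toLp 2 y) :=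
  ((PiLp.volume_preserving_toLp (Fin n)).lintegral_comp_emb (toLp_emb n) g).symm

lemma Apq_ball (n : ℕ) (p q : ℝ) (hp : 1 < p) (hq : 0 < q) (w : Euc n → ℝ)
    (x : Fin n → ℝ) (r : ℝ) (hr : 0 < r) :
    (volume (Metric.ball x r))⁻¹ * (volume.withDensity fun y : Fin n → ℝ =>
        ENNReal.ofReal (w (WithLp.toLp 2 y)) ^ q) (Metric.ball x r) *
      ((volume (Metric.ball x r))⁻¹ * (volume.withDensity fun y : Fin n → ℝ =>
        ENNReal.ofReal (w (WithLp.toLp 2 y)) ^ (-dualExp p)) (Metric.ball x r)) ^ (q / dualExp p)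
      ≤ Apq p q w := by
  have hd : 0 < dualExp p := by unfold dualExp; have : 0 < p - 1 := by linarith
                                positivity
  set a : Euc n := WithLp.toLp 2 (fun i => x i - r) with ha
  have h1 : (fun i => a i + 2 * r / 2) = x := by
    ext i; simp [ha]
  have h2 : 2 * r / 2 = r := by ring
  have hv : volume (Metric.ball x r) = volume (Cube a (2 * r)) := by
    rw [vol_cube n a _ (by positivity), Real.volume_pi_ball _ hr, Fintype.card_fin]
  have h3 := le_iSup_of_le (f := fun a : Euc n => ⨆ (h : ℝ) (_ : 0 < h),
    ((volume (Cube a h))⁻¹ * ∫⁻ x in Cube a h, ENNReal.ofReal (w x) ^ q) *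
      (if p = 1 then
        (essSup (fun x => (ENNReal.ofReal (w x))⁻¹) (volume.restrict (Cube a h))) ^ q
      else
        ((volume (Cube a h))⁻¹ * ∫⁻ x in Cube a h,
            ENNReal.ofReal (w x) ^ (-(dualExp p))) ^ (q / dualExp p))) a
    (le_iSup_of_le (2 * r) (le_iSup_of_le (by positivity) le_rfl))
  refine le_trans ?_ h3
  rw [if_neg hp.ne', hv, withDensity_apply _ Metric.isOpen_ball.measurableSet,
    withDensity_apply _ Metric.isOpen_ball.measurableSet, int_cube n a _ (by positivity),
    int_cube n a _ (by positivity), h1, h2]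
  have hsub : Metric.ball x r ⊆ Metric.closedBall x r := Metric.ball_subset_closedBall
  gcongr

lemma fracMax_le (n : ℕ) (hn : 0 < n) (α β : ℝ) (hβ : β = 1 - α / n) (hβ0 : 0 < β)
    (f : Euc n → ℝ) (y : Fin n → ℝ) :
    fracMax α f (WithLp.toLp 2 y) ≤ ENNReal.ofReal (4 ^ n) ^ β *
      cM volume β (fun y => ENNReal.ofReal |f (WithLp.toLp 2 y)|) y := by
  unfold fracMax
  refine iSup_le fun a => iSup_le fun h => iSup_le fun hh => iSup_le fun hy => ?_
  obtain ⟨r, hr1, hr2⟩ := exists_rat_btwn (show h < 2 * h by linarith)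
  have hr0 : (0 : ℝ) < r := hh.trans hr1
  have hy' : y ∈ (WithLp.toLp 2 : (Fin n → ℝ) → Euc n) ⁻¹' Cube a h := hy
  rw [preimage_cube n a h hh.le, Metric.mem_closedBall] at hy'
  have hsub : Metric.closedBall (fun i => a i + h / 2) (h / 2) ⊆ Metric.ball y r := by
    intro z hz
    rw [Metric.mem_closedBall] at hz
    rw [Metric.mem_ball]
    have := dist_triangle_right z y (fun i => a i + h / 2)
    linarith
  have hle := le_iSup (fun r : {r : ℚ // 0 < r} => volume (Metric.ball y (r : ℚ)) ^ (-β) *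
    ∫⁻ z in Metric.ball y (r : ℚ), ENNReal.ofReal |f (WithLp.toLp 2 z)|)
    ⟨r, by exact_mod_cast hr0⟩
  refine le_trans ?_ (mul_le_mul_right hle _)
  rw [← mul_assoc, int_cube n a h hh.le, vol_cube n a h hh.le]
  refine mul_le_mul' ?_ (lintegral_mono_set hsub)
  rw [Real.volume_pi_ball _ hr0, Fintype.card_fin]
  have e1 : α / n - 1 = -β := by rw [hβ]; ring
  have p4 : (0 : ℝ) < 4 ^ n := by positivity
  have ph : (0 : ℝ) < h ^ n := by positivity
  have pr : (0 : ℝ) < (2 * r) ^ n := by positivity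
  rw [e1, ENNReal.ofReal_rpow_of_pos p4, ENNReal.ofReal_rpow_of_pos ph,
    ENNReal.ofReal_rpow_of_pos pr, ← ENNReal.ofReal_mul (by positivity)]
  refine ENNReal.ofReal_le_ofReal ?_
  rw [Real.rpow_neg ph.le, Real.rpow_neg pr.le, ← div_eq_mul_inv, ← one_div,
    div_le_div_iff₀ (by positivity) (by positivity), one_mul, ← Real.mul_rpow p4.le ph.le, ← mul_pow]
  refine Real.rpow_le_rpow pr.le ?_ hβ0.le
  exact pow_le_pow_left₀ (by positivity) (by linarith) n

/-- Sharp bound for the fractional maximal operator (Theorem 2.8). -/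
theorem fracMax_sharp_bound
    (n : ℕ) (hn : 0 < n) (α p q : ℝ) (hα : 0 ≤ α) (hαn : α < n)
    (hp : 1 < p) (hpn : α * p < n) (hq : 1 / q = 1 / p - α / n) :
    ∃ c : ℝ, 0 < c ∧ ∀ w f : Euc n → ℝ, Measurable w → (∀ x, 0 ≤ w x) → Measurable f →
      Apq p q w < ⊤ →
      wLpE w (fracMax α f) q ≤
        ENNReal.ofReal c * Apq p q w ^ (dualExp p / q * (1 - α / n)) * wLp w f p := by
  have hn' : (0 : ℝ) < n := by exact_mod_cast hn
  have hp0 : 0 < p := by linarith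
  have hp1 : 0 < p - 1 := by linarith
  have hiq : 0 < 1 / q := by
    rw [hq, sub_pos, div_lt_div_iff₀ hn' hp0]; linarith
  have hq0 : 0 < q := by
    rw [one_div] at hiq; exact inv_pos.1 hiq
  have hpq : p ≤ q := by
    have h1 : 1 / q ≤ 1 / p := by
      rw [hq]; have : 0 ≤ α / n := by positivity
      linarith
    exact (one_div_le_one_div hq0 hp0).1 h1
  set β := 1 - α / n with hβ
  have hβ0 : 0 < β := by rw [hβ, sub_pos, div_lt_one hn']; exact hαn
  have hβ' : β = 1 - 1 / p + 1 / q := by rw [hq, hβ]; ring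
  obtain ⟨C, hC, hcore⟩ := core n p q β (dualExp p) hp hpq hβ' rfl
  set D : ℝ≥0∞ := ENNReal.ofReal (4 ^ n) ^ β with hD
  have hDT : D ≠ ⊤ := ENNReal.rpow_ne_top_of_nonneg hβ0.le ENNReal.ofReal_ne_top
  have hCT : D * C ^ (1 / q) ≠ ⊤ :=
    ENNReal.mul_ne_top hDT (ENNReal.rpow_ne_top_of_nonneg hiq.le hC)
  refine ⟨(D * C ^ (1 / q)).toReal + 1, by positivity, ?_⟩
  intro w f hw hw0 hf hA
  have hcc : D * C ^ (1 / q) ≤ ENNReal.ofReal ((D * C ^ (1 / q)).toReal + 1) := by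
    rw [ENNReal.le_ofReal_iff_toReal_le hCT (by positivity)]
    linarith
  have htm : Measurable (WithLp.toLp 2 : (Fin n → ℝ) → Euc n) := (toLp_emb n).measurable
  have hmain := hcore (fun y => ENNReal.ofReal (w (WithLp.toLp 2 y)))
    (fun y => ENNReal.ofReal |f (WithLp.toLp 2 y)|)
    (hw.comp htm).ennreal_ofReal (hf.comp htm).abs.ennreal_ofReal
    (fun _ => ENNReal.ofReal_ne_top) (Apq p q w) hA.ne
    (fun x r hr => Apq_ball n p q hp hq0 w x r hr)
  set F : (Fin n → ℝ) → ℝ≥0∞ := fun y => ENNReal.ofReal |f (WithLp.toLp 2 y)| with hF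
  unfold wLpE wLp
  rw [int_all, int_all n (fun x => (ENNReal.ofReal (w x) * ENNReal.ofReal |f x|) ^ p)]
  set L := ∫⁻ y : Fin n → ℝ, (ENNReal.ofReal (w (WithLp.toLp 2 y)) *
    ENNReal.ofReal |f (WithLp.toLp 2 y)|) ^ p with hL
  have h1 : ∫⁻ y : Fin n → ℝ, (ENNReal.ofReal (w (WithLp.toLp 2 y)) *
      fracMax α f (WithLp.toLp 2 y)) ^ q ≤
      D ^ q * (C * Apq p q w ^ (dualExp p * β) * L ^ (q / p)) := by
    calc _ ≤ ∫⁻ y : Fin n → ℝ, D ^ q * (ENNReal.ofReal (w (WithLp.toLp 2 y)) *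
          cM volume β F y) ^ q := by
          refine lintegral_mono fun y => ?_
          rw [← ENNReal.mul_rpow_of_nonneg _ _ hq0.le, mul_left_comm]
          exact ENNReal.rpow_le_rpow (mul_le_mul_right (fracMax_le n hn α β hβ hβ0 f y) _) hq0.le
      _ = D ^ q * ∫⁻ y : Fin n → ℝ, (ENNReal.ofReal (w (WithLp.toLp 2 y)) *
          cM volume β F y) ^ q :=
          lintegral_const_mul' _ _ (ENNReal.rpow_ne_top_of_nonneg hq0.le hDT)
      _ ≤ _ := mul_le_mul_right hmain _
  clear_value D
  calc _ ≤ (D ^ q * (C * Apq p q w ^ (dualExp p * β) * L ^ (q / p))) ^ (1 / q) :=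
        ENNReal.rpow_le_rpow h1 hiq.le
    _ = D * C ^ (1 / q) * Apq p q w ^ (dualExp p / q * β) * L ^ (1 / p) := by
        rw [ENNReal.mul_rpow_of_nonneg _ _ hiq.le, ENNReal.mul_rpow_of_nonneg _ _ hiq.le,
          ENNReal.mul_rpow_of_nonneg _ _ hiq.le, ← ENNReal.rpow_mul, ← ENNReal.rpow_mul,
          ← ENNReal.rpow_mul, mul_one_div_cancel hq0.ne', ENNReal.rpow_one]
        have e1 : dualExp p * β * (1 / q) = dualExp p / q * β := by ring
        have e2 : q / p * (1 / q) = 1 / p := by field_simp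
        rw [e1, e2]; ring
    _ ≤ _ := by gcongr

end
end

section
/- Sharpness of the exponent for the fractional maximal operator: Let 0 < α < n, 1 < p < n/α, and define q by 1/q = 1/p − α/n. Then for every exponent γ with 0 ≤ γ < (p′/q)(1−α/n) there is NO constant c such that ‖w·M_α f‖_{L^{q}(ℝⁿ)} ≤ c [w]_{A_{p,q}}^{γ} ‖w·f‖_{L^{p}(ℝⁿ)} holds for all weights w ∈ A_{p,q} and all measurable f. -/
open MeasureTheory ENNReal Set

noncomputable section

variable {n : ℕ}

/-- sup norm on `Euc n`. -/
def supN (x : Euc n) : ℝ := ‖WithLp.ofLp x‖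

/-- the dimensional constant. -/
def kap (n : ℕ) : ℝ := n * volume.real (Metric.ball (0 : Fin n → ℝ) 1)

lemma kap_pos (hn : 0 < n) : 0 < kap n := by
  unfold kap
  have h : 0 < volume.real (Metric.ball (0 : Fin n → ℝ) 1) := by
    rw [Measure.real, ENNReal.toReal_pos_iff]
    exact ⟨Metric.measure_ball_pos _ _ one_pos, measure_ball_lt_top⟩
  positivity

lemma supN_nonneg (x : Euc n) : 0 ≤ supN x := norm_nonneg _

lemma supN_meas : Measurable (supN : Euc n → ℝ) := by
  unfold supN
  exact measurable_norm.comp (PiLp.volume_preserving_ofLp (Fin n)).measurable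

lemma supN_pos_ae (hn : 0 < n) : ∀ᵐ x : Euc n, 0 < supN x := by
  have : Nonempty (Fin n) := ⟨⟨0, hn⟩⟩
  have h : ({0} : Set (Euc n))ᶜ ∈ ae (volume : Measure (Euc n)) := by
    rw [compl_mem_ae_iff]
    exact measure_singleton _
  filter_upwards [h] with x hx
  unfold supN
  rw [norm_pos_iff]
  intro h0
  apply hx
  simp only [mem_singleton_iff]
  ext i
  simpa using congrFun h0 i

lemma radial_int (hn : 0 < n) {R s : ℝ} (hR : 0 < R) (hs : 0 < s) :
    ∫⁻ x in {x : Euc n | supN x ≤ R}, ENNReal.ofReal (supN x ^ (s - n))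
      = ENNReal.ofReal (kap n * (R ^ s / s)) := by
  have : Nonempty (Fin n) := ⟨⟨0, hn⟩⟩
  set f : ℝ → ℝ := (Iic R).indicator (fun y => y ^ (s - n)) with hf
  have hm : MeasurableSet {x : Euc n | supN x ≤ R} := supN_meas measurableSet_Iic
  have h1 : ∫⁻ x in {x : Euc n | supN x ≤ R}, ENNReal.ofReal (supN x ^ (s - n))
      = ∫⁻ x : Euc n, ENNReal.ofReal (f ‖WithLp.ofLp x‖) := by
    rw [← lintegral_indicator hm]
    congr 1
    ext x
    by_cases hx : supN x ≤ R
    · have hx' : ‖WithLp.ofLp x‖ ≤ R := hx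
      simp [hf, indicator, hx', supN]
    · have hx' : ¬ ‖WithLp.ofLp x‖ ≤ R := hx
      simp [hf, indicator, hx, hx']
  have hfm : Measurable f := (by fun_prop : Measurable (fun y : ℝ => y ^ (s - n))).indicator measurableSet_Iic
  have hg : Measurable (fun y : Fin n → ℝ => ENNReal.ofReal (f ‖y‖)) := by fun_prop
  rw [h1, (PiLp.volume_preserving_ofLp (Fin n)).lintegral_comp hg]
  have hpt : EqOn (fun y : ℝ ↦ y ^ (Module.finrank ℝ (Fin n → ℝ) - 1) • f y)
      ((Ioc 0 R).indicator (fun y => y ^ (s - 1))) (Ioi 0) := by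
    intro y hy
    have hy0 : (0:ℝ) < y := hy
    by_cases hyR : y ≤ R
    · simp only [hf, Module.finrank_fin_fun, smul_eq_mul]
      rw [indicator_of_mem (show y ∈ Iic R from hyR), indicator_of_mem (show y ∈ Ioc 0 R from ⟨hy0, hyR⟩),
        ← Real.rpow_natCast, ← Real.rpow_add hy0]
      congr 1
      push_cast [Nat.cast_sub (Nat.succ_le_of_lt hn)]
      ring
    · simp [hf, indicator, hyR]
  have hii : IntegrableOn (fun y : ℝ => y ^ (s - 1)) (Ioc 0 R) := by
    have := intervalIntegral.intervalIntegrable_rpow' (a := 0) (b := R) (r := s - 1) (by linarith)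
    rwa [intervalIntegrable_iff_integrableOn_Ioc_of_le hR.le] at this
  have hint : Integrable (fun y : Fin n → ℝ => f ‖y‖) volume := by
    rw [integrable_fun_norm_addHaar volume (f := f)]
    rw [integrableOn_congr_fun hpt measurableSet_Ioi]
    exact (hii.integrable_indicator measurableSet_Ioc).integrableOn
  rw [← ofReal_integral_eq_lintegral_ofReal hint]
  · congr 1
    rw [integral_fun_norm_addHaar volume f, setIntegral_congr_fun measurableSet_Ioi hpt,
      setIntegral_indicator measurableSet_Ioc]
    have : Ioi (0:ℝ) ∩ Ioc 0 R = Ioc 0 R := by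
      ext y; simp only [mem_inter_iff, mem_Ioi, mem_Ioc]; tauto
    rw [this, ← intervalIntegral.integral_of_le hR.le, integral_rpow (Or.inl (by linarith))]
    simp only [Module.finrank_fin_fun, nsmul_eq_mul, smul_eq_mul, sub_add_cancel, kap]
    rw [Real.zero_rpow hs.ne']
    ring
  · refine Filter.Eventually.of_forall fun y => ?_
    simp only [hf, Pi.zero_apply]
    by_cases hy : ‖y‖ ≤ R
    · rw [indicator_of_mem (show ‖y‖ ∈ Iic R from hy)]
      positivity
    · rw [indicator_of_notMem (show ‖y‖ ∉ Iic R from hy)]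

lemma volume_Cube (a : Euc n) {h : ℝ} (hh : 0 < h) :
    volume (Cube a h) = ENNReal.ofReal (h ^ (n : ℝ)) := by
  have h1 : Cube a h = WithLp.ofLp ⁻¹' (Icc (WithLp.ofLp a) (fun i => a i + h)) := by
    ext x
    simp only [Cube, mem_ofPred_eq, mem_preimage, mem_Icc, Pi.le_def]
    exact forall_and
  rw [h1, (PiLp.volume_preserving_ofLp (Fin n)).measure_preimage measurableSet_Icc.nullMeasurableSet,
    Real.volume_Icc_pi]
  simp [ENNReal.ofReal_pow hh.le]

lemma Cube_center {ρ : ℝ} (hρ : 0 ≤ ρ) :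
    Cube (WithLp.toLp 2 (fun _ => -ρ) : Euc n) (2 * ρ) = {x | supN x ≤ ρ} := by
  ext x
  simp only [Cube, mem_ofPred_eq, supN]
  rw [pi_norm_le_iff_of_nonneg hρ]
  refine forall_congr' fun i => ?_
  rw [Real.norm_eq_abs, abs_le]
  constructor <;> rintro ⟨h1, h2⟩ <;> constructor <;> linarith

lemma Cube_osc {a : Euc n} {h : ℝ} (hh : 0 < h) {x y : Euc n} (hx : x ∈ Cube a h)
    (hy : y ∈ Cube a h) : supN x ≤ supN y + h := by
  have h1 : ‖WithLp.ofLp x - WithLp.ofLp y‖ ≤ h := by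
    rw [pi_norm_le_iff_of_nonneg hh.le]
    intro i
    rw [Pi.sub_apply, Real.norm_eq_abs, abs_le]
    have := hx i
    have := hy i
    constructor <;> linarith
  have := norm_sub_norm_le (WithLp.ofLp x) (WithLp.ofLp y)
  unfold supN
  linarith

lemma Cube_meas (a : Euc n) (h : ℝ) : MeasurableSet (Cube a h) := by
  have h1 : Cube a h = WithLp.ofLp ⁻¹' (Icc (WithLp.ofLp a) (fun i => a i + h)) := by
    ext x
    simp only [Cube, mem_ofPred_eq, mem_preimage, mem_Icc, Pi.le_def]
    exact forall_and
  rw [h1]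
  exact (PiLp.volume_preserving_ofLp (Fin n)).measurable measurableSet_Icc

lemma avg_le (a : Euc n) {h : ℝ} (hh : 0 < h) (g : Euc n → ℝ≥0∞) (c : ℝ≥0∞)
    (hg : ∀ᵐ x : Euc n, x ∈ Cube a h → g x ≤ c) :
    (volume (Cube a h))⁻¹ * ∫⁻ x in Cube a h, g x ≤ c := by
  have h1 : ∫⁻ x in Cube a h, g x ≤ c * volume (Cube a h) := by
    rw [← setLIntegral_const]
    exact setLIntegral_mono_ae' (Cube_meas a h) hg
  have h0 : volume (Cube a h) ≠ 0 := by
    rw [volume_Cube a hh]; simp; positivity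
  have ht : volume (Cube a h) ≠ ⊤ := by
    rw [volume_Cube a hh]; simp
  calc _ ≤ (volume (Cube a h))⁻¹ * (c * volume (Cube a h)) := by gcongr
    _ = c := by rw [mul_comm c, ← mul_assoc, ENNReal.inv_mul_cancel h0 ht, one_mul]

/-- the power weight. -/
def wt (δ r : ℝ) (x : Euc n) : ℝ := supN x ^ (((n : ℝ) - δ) / r)

/-- the test function. -/
def ft (δ : ℝ) : Euc n → ℝ := {x | supN x ≤ 1}.indicator (fun x => supN x ^ (δ - (n : ℝ)))

lemma wt_nonneg (δ r : ℝ) (x : Euc n) : 0 ≤ wt δ r x := Real.rpow_nonneg (supN_nonneg x) _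

lemma wt_meas (δ r : ℝ) : Measurable (wt δ r : Euc n → ℝ) := supN_meas.pow_const _

lemma ft_meas (δ : ℝ) : Measurable (ft δ : Euc n → ℝ) :=
  (supN_meas.pow_const _).indicator (supN_meas measurableSet_Iic)

lemma wt_neg {δ r : ℝ} (hr : 0 < r) {x : Euc n} (hx : 0 < supN x) :
    ENNReal.ofReal (wt δ r x) ^ (-r) = ENNReal.ofReal (supN x ^ (δ - (n : ℝ))) := by
  unfold wt
  rw [ENNReal.ofReal_rpow_of_pos (by positivity), ← Real.rpow_mul hx.le]
  congr 2
  field_simp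
  ring

lemma wt_pos_le {δ r q M : ℝ} (hr : 0 < r) (hq : 0 < q) (hδ : δ ≤ n) {x : Euc n}
    (hx : supN x ≤ M) :
    ENNReal.ofReal (wt δ r x) ^ q ≤ ENNReal.ofReal ((M ^ ((n : ℝ) - δ)) ^ (q / r)) := by
  unfold wt
  have h0 := supN_nonneg x
  have hM := h0.trans hx
  rw [ENNReal.ofReal_rpow_of_nonneg (by positivity) hq.le]
  apply ENNReal.ofReal_le_ofReal
  rw [← Real.rpow_mul h0, ← Real.rpow_mul hM]
  have : ((n : ℝ) - δ) / r * q = ((n : ℝ) - δ) * (q / r) := by ring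
  rw [this]
  apply Real.rpow_le_rpow h0 hx
  have : 0 ≤ (n : ℝ) - δ := by linarith
  positivity

lemma Apq_wt_le (hn : 0 < n) {p q δ : ℝ} (hp : 1 < p) (hq : 0 < q) (hδ0 : 0 < δ) (hδ1 : δ < 1) :
    Apq p q (wt δ (dualExp p) : Euc n → ℝ) ≤
      ENNReal.ofReal (((4 : ℝ) ^ (n : ℝ) * (kap n + 1) / δ) ^ (q / dualExp p)) := by
  have hr : 0 < dualExp p := by unfold dualExp; apply div_pos <;> linarith
  set r := dualExp p with hrdef
  have hκ := kap_pos hn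
  have hn1 : (1:ℝ) ≤ n := by exact_mod_cast hn
  have hqr : 0 < q / r := by positivity
  unfold Apq
  refine iSup_le fun a => iSup_le fun h => iSup_le fun hh => ?_
  rw [if_neg hp.ne', ← hrdef]
  by_cases hc : ∃ x0 ∈ Cube a h, supN x0 ≤ h
  · obtain ⟨x0, hx0, hx0h⟩ := hc
    have hsub : Cube a h ⊆ {x | supN x ≤ 2 * h} := by
      intro x hx
      have := Cube_osc hh hx hx0
      show supN x ≤ 2 * h
      linarith
    have e1 : (volume (Cube a h))⁻¹ * ∫⁻ x in Cube a h, ENNReal.ofReal (wt δ r x) ^ q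
        ≤ ENNReal.ofReal (((2 * h) ^ ((n : ℝ) - δ)) ^ (q / r)) :=
      avg_le a hh _ _ (Filter.Eventually.of_forall fun x hx =>
        wt_pos_le hr hq (by linarith) (hsub hx))
    have e2 : ∫⁻ x in Cube a h, ENNReal.ofReal (wt δ r x) ^ (-r)
        ≤ ENNReal.ofReal (kap n * ((2 * h) ^ δ / δ)) := by
      rw [← radial_int hn (by positivity : 0 < 2 * h) hδ0]
      refine (lintegral_mono_set hsub).trans (le_of_eq ?_)
      apply lintegral_congr_ae
      filter_upwards [ae_restrict_of_ae (supN_pos_ae hn)] with x hx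
      exact wt_neg hr hx
    have e3 : (volume (Cube a h))⁻¹ * ∫⁻ x in Cube a h, ENNReal.ofReal (wt δ r x) ^ (-r)
        ≤ ENNReal.ofReal ((h ^ (n : ℝ))⁻¹ * (kap n * ((2 * h) ^ δ / δ))) := by
      rw [volume_Cube a hh, ENNReal.ofReal_mul (by positivity),
        ENNReal.ofReal_inv_of_pos (by positivity)]
      gcongr
    calc _ ≤ ENNReal.ofReal (((2 * h) ^ ((n : ℝ) - δ)) ^ (q / r)) *
          (ENNReal.ofReal ((h ^ (n : ℝ))⁻¹ * (kap n * ((2 * h) ^ δ / δ)))) ^ (q / r) := by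
            gcongr
      _ = ENNReal.ofReal ((2 ^ (n : ℝ) * kap n / δ) ^ (q / r)) := by
            rw [ENNReal.ofReal_rpow_of_nonneg (by positivity) hqr.le,
              ← ENNReal.ofReal_mul (by positivity), ← Real.mul_rpow (by positivity) (by positivity)]
            congr 2
            have : (2 * h) ^ ((n : ℝ) - δ) = 2 ^ (n:ℝ) * h ^ (n:ℝ) / (2 * h) ^ δ := by
              rw [Real.rpow_sub (by positivity), Real.mul_rpow (by positivity) (by positivity)]
            rw [this]
            field_simp
      _ ≤ _ := by
            gcongr
            · norm_num
            · linarith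
  · push Not at hc
    have ha : a ∈ Cube a h := fun i => ⟨le_rfl, by linarith⟩
    set m := supN a with hm
    have hmh : h < m := hc a ha
    have hm0 : 0 < m := hh.trans hmh
    have e1 : (volume (Cube a h))⁻¹ * ∫⁻ x in Cube a h, ENNReal.ofReal (wt δ r x) ^ q
        ≤ ENNReal.ofReal (((2 * m) ^ ((n : ℝ) - δ)) ^ (q / r)) := by
      refine avg_le a hh _ _ (Filter.Eventually.of_forall fun x hx =>
        wt_pos_le hr hq (by linarith) ?_)
      have := Cube_osc hh hx ha
      linarith
    have e3 : (volume (Cube a h))⁻¹ * ∫⁻ x in Cube a h, ENNReal.ofReal (wt δ r x) ^ (-r)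
        ≤ ENNReal.ofReal ((m / 2) ^ (δ - (n : ℝ))) := by
      refine avg_le a hh _ _ (Filter.Eventually.of_forall fun x hx => ?_)
      have h1 := Cube_osc hh ha hx
      have h2 := hc x hx
      rw [wt_neg hr (hh.trans h2)]
      apply ENNReal.ofReal_le_ofReal
      apply Real.rpow_le_rpow_of_nonpos (by positivity) (by linarith) (by linarith)
    calc _ ≤ ENNReal.ofReal (((2 * m) ^ ((n : ℝ) - δ)) ^ (q / r)) *
          (ENNReal.ofReal ((m / 2) ^ (δ - (n : ℝ)))) ^ (q / r) := by
            gcongr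
      _ = ENNReal.ofReal ((4 ^ ((n : ℝ) - δ)) ^ (q / r)) := by
            rw [ENNReal.ofReal_rpow_of_nonneg (by positivity) hqr.le,
              ← ENNReal.ofReal_mul (by positivity), ← Real.mul_rpow (by positivity) (by positivity)]
            congr 2
            rw [show δ - (n:ℝ) = -((n:ℝ) - δ) by ring, Real.rpow_neg (by positivity),
              ← Real.inv_rpow (by positivity), ← Real.mul_rpow (by positivity) (by positivity)]
            congr 1
            field_simp
            norm_num
      _ ≤ _ := by
            apply ENNReal.ofReal_le_ofReal
            apply Real.rpow_le_rpow (by positivity) _ hqr.le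
            have h4 : (4:ℝ) ^ ((n : ℝ) - δ) ≤ 4 ^ (n:ℝ) :=
              Real.rpow_le_rpow_of_exponent_le (by norm_num) (by linarith)
            have h5 : (0:ℝ) < 4 ^ (n:ℝ) := by positivity
            rw [le_div_iff₀ hδ0]
            nlinarith

lemma wLp_le (hn : 0 < n) {p δ : ℝ} (hp : 1 < p) (hδ0 : 0 < δ) (hδ1 : δ < 1) :
    wLp (wt δ (dualExp p) : Euc n → ℝ) (ft δ) p ≤ ENNReal.ofReal ((kap n / δ) ^ (1 / p)) := by
  have hp0 : 0 < p := by linarith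
  have hκ := kap_pos hn
  unfold wLp
  rw [← ENNReal.ofReal_rpow_of_nonneg (by positivity) (by positivity)]
  apply ENNReal.rpow_le_rpow _ (by positivity)
  have hm : MeasurableSet {x : Euc n | supN x ≤ 1} := supN_meas measurableSet_Iic
  have h1 := radial_int hn one_pos hδ0
  rw [Real.one_rpow, mul_one_div] at h1
  rw [← h1, ← lintegral_indicator hm]
  apply lintegral_mono_ae
  filter_upwards [supN_pos_ae hn] with x hx
  by_cases hx1 : supN x ≤ 1
  · have hmem : x ∈ {x : Euc n | supN x ≤ 1} := hx1
    rw [ft, indicator_of_mem hmem, indicator_of_mem hmem, wt, abs_of_nonneg (by positivity),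
      ← ENNReal.ofReal_mul (by positivity), ENNReal.ofReal_rpow_of_nonneg (by positivity) hp0.le,
      ← Real.rpow_add hx, ← Real.rpow_mul hx.le]
    apply le_of_eq
    congr 2
    have : p - 1 ≠ 0 := by linarith
    unfold dualExp
    field_simp
    ring
  · have hmem : x ∉ {x : Euc n | supN x ≤ 1} := hx1
    rw [ft, indicator_of_notMem hmem, indicator_of_notMem hmem]
    simp [hp0]

lemma fracMax_ge (hn : 0 < n) {α δ : ℝ} (hδ0 : 0 < δ) {x : Euc n}
    (hx : 0 < supN x) (hx1 : supN x ≤ 1) :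
    ENNReal.ofReal (2 ^ (α - n) * (kap n / δ) * supN x ^ (α - n + δ)) ≤ fracMax α (ft δ) x := by
  have hκ := kap_pos hn
  have hn0 : (0:ℝ) < n := by exact_mod_cast hn
  set ρ := supN x with hρ
  have hc := Cube_center (n := n) hx.le
  have hmem : x ∈ Cube (WithLp.toLp 2 (fun _ => -ρ) : Euc n) (2 * ρ) := by
    rw [hc]; exact le_refl (supN x)
  unfold fracMax
  refine le_trans (le_of_eq ?_) (le_iSup₂_of_le (WithLp.toLp 2 (fun _ => -ρ) : Euc n) (2 * ρ)
    (le_iSup₂_of_le (by positivity) hmem le_rfl))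
  rw [volume_Cube _ (by positivity), hc]
  have hI : ∫⁻ y in {y : Euc n | supN y ≤ ρ}, ENNReal.ofReal |ft δ y|
      = ENNReal.ofReal (kap n * (ρ ^ δ / δ)) := by
    rw [← radial_int hn hx hδ0]
    apply setLIntegral_congr_fun (supN_meas measurableSet_Iic)
    intro y hy
    have hy' : supN y ≤ ρ := hy
    have hmem' : y ∈ {x : Euc n | supN x ≤ 1} := hy'.trans hx1
    have := supN_nonneg y
    simp only
    rw [ft, indicator_of_mem hmem', abs_of_nonneg (by positivity)]
  rw [hI, ENNReal.ofReal_rpow_of_pos (by positivity), ← ENNReal.ofReal_mul (by positivity),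
    ← Real.rpow_mul (by positivity)]
  congr 1
  rw [show (n:ℝ) * (α / n - 1) = α - n by field_simp, Real.mul_rpow (by positivity) hx.le,
    Real.rpow_add hx]
  ring

lemma wLpE_ge (hn : 0 < n) {α p q δ : ℝ} (hp : 1 < p) (hq0 : 0 < q)
    (hq : 1 / q = 1 / p - α / n) (hδ0 : 0 < δ) :
    ENNReal.ofReal (2 ^ (α - n) * (kap n / δ) * (kap n / (δ * q / p)) ^ (1 / q)) ≤
      wLpE (wt δ (dualExp p) : Euc n → ℝ) (fracMax α (ft δ)) q := by
  have hp0 : 0 < p := by linarith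
  have hn0 : (0:ℝ) < n := by exact_mod_cast hn
  have hκ := kap_pos hn
  set A : ℝ := 2 ^ (α - n) * (kap n / δ) with hA
  have hA0 : 0 < A := by positivity
  have hm : MeasurableSet {x : Euc n | supN x ≤ 1} := supN_meas measurableSet_Iic
  have hs : 0 < δ * q / p := by positivity
  have h1 := radial_int hn one_pos hs
  rw [Real.one_rpow, mul_one_div] at h1
  have key : ENNReal.ofReal (A ^ q * (kap n / (δ * q / p))) ≤
      ∫⁻ x : Euc n, (ENNReal.ofReal (wt δ (dualExp p) x) * fracMax α (ft δ) x) ^ q := by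
    rw [ENNReal.ofReal_mul (by positivity), ← h1, ← lintegral_const_mul' _ _ ENNReal.ofReal_ne_top]
    refine le_trans ?_ (setLIntegral_le_lintegral {x : Euc n | supN x ≤ 1} _)
    apply setLIntegral_mono_ae' hm
    filter_upwards [supN_pos_ae hn] with x hx hx1
    refine le_trans (le_of_eq ?_) (ENNReal.rpow_le_rpow
      (mul_le_mul_right (fracMax_ge (α := α) hn hδ0 hx hx1) _) hq0.le)
    rw [wt, ← ENNReal.ofReal_mul (by positivity), ← ENNReal.ofReal_mul (by positivity),
      ENNReal.ofReal_rpow_of_nonneg (by positivity) hq0.le]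
    congr 1
    rw [← hA, mul_left_comm, ← Real.rpow_add hx,
      Real.mul_rpow (x := A) hA0.le (Real.rpow_nonneg hx.le _), ← Real.rpow_mul hx.le]
    congr 2
    have : p - 1 ≠ 0 := by linarith
    have hα : α = n / p - n / q := by
      field_simp at hq ⊢
      linarith
    rw [hα]
    unfold dualExp
    field_simp
    ring
  unfold wLpE
  refine le_trans (le_of_eq ?_) (ENNReal.rpow_le_rpow key (by positivity))
  rw [ENNReal.ofReal_rpow_of_nonneg (by positivity) (by positivity),
    Real.mul_rpow (by positivity) (by positivity), ← Real.rpow_mul hA0.le,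
    mul_one_div_cancel hq0.ne', Real.rpow_one]

/-- Sharpness of the exponent `(p'/q)(1-α/n)` for the fractional maximal
operator (Theorem 2.8, sharpness part). -/
theorem fracMax_exponent_sharp
    (n : ℕ) (hn : 0 < n) (α p q : ℝ) (hα : 0 < α) (hαn : α < n)
    (hp : 1 < p) (hpn : p < n / α) (hq : 1 / q = 1 / p - α / n)
    (γ : ℝ) (hγ0 : 0 ≤ γ) (hγ : γ < dualExp p / q * (1 - α / n)) :
    ¬ ∃ c : ℝ, 0 < c ∧ ∀ w f : Euc n → ℝ, Measurable w → (∀ x, 0 ≤ w x) → Measurable f →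
      Apq p q w < ⊤ →
      wLpE w (fracMax α f) q ≤
        ENNReal.ofReal c * Apq p q w ^ γ * wLp w f p := by
  rintro ⟨c, hc, H⟩
  have hp0 : 0 < p := by linarith
  have hn0 : (0:ℝ) < n := by exact_mod_cast hn
  have hκ := kap_pos hn
  have hr : 0 < dualExp p := by unfold dualExp; apply div_pos <;> linarith
  have hq0 : 0 < q := by
    rw [← one_div_pos, hq, sub_pos, div_lt_div_iff₀ hn0 hp0]
    rw [lt_div_iff₀ hα] at hpn
    linarith
  set D : ℝ := (4 : ℝ) ^ (n : ℝ) * (kap n + 1) with hD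
  have hD0 : 0 < D := by positivity
  have hqr : 0 < q / dualExp p := by positivity
  have key : ∀ t : ℝ, 1 < t →
      (2 ^ (α - n) * kap n * (kap n * p / q) ^ (1 / q)) * t ^ (1 + 1 / q) ≤
      (c * (D ^ (q / dualExp p * γ)) * kap n ^ (1 / p)) * t ^ (q / dualExp p * γ + 1 / p) := by
    intro t ht
    have ht0 : 0 < t := by linarith
    have hδ0 : 0 < 1 / t := by positivity
    have hδ1 : 1 / t < 1 := by rw [div_lt_one ht0]; exact ht
    have hA := Apq_wt_le hn hp hq0 hδ0 hδ1
    have h1 := H (wt (1 / t) (dualExp p)) (ft (1 / t)) (wt_meas _ _) (wt_nonneg _ _) (ft_meas _)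
      (hA.trans_lt ENNReal.ofReal_lt_top)
    have h2 := (wLpE_ge hn (α := α) hp hq0 hq hδ0).trans h1
    have h3 : ENNReal.ofReal c * Apq p q (wt (1 / t) (dualExp p) : Euc n → ℝ) ^ γ *
        wLp (wt (1 / t) (dualExp p) : Euc n → ℝ) (ft (1 / t)) p ≤
        ENNReal.ofReal c * (ENNReal.ofReal ((D / (1 / t)) ^ (q / dualExp p))) ^ γ *
          ENNReal.ofReal ((kap n / (1 / t)) ^ (1 / p)) := by
      gcongr
      exact wLp_le hn hp hδ0 hδ1
    have h4 := h2.trans h3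
    rw [ENNReal.ofReal_rpow_of_nonneg (by positivity) hγ0, ← ENNReal.ofReal_mul (by positivity),
      ← ENNReal.ofReal_mul (by positivity), ENNReal.ofReal_le_ofReal_iff (by positivity)] at h4
    have e1 : D / (1 / t) = D * t := by field_simp
    have e2 : kap n / (1 / t) = kap n * t := by field_simp
    have e3 : kap n / (1 / t * q / p) = kap n * p / q * t := by field_simp
    rw [e1, e2, e3, ← Real.rpow_mul (by positivity), Real.mul_rpow (by positivity) ht0.le,
      Real.mul_rpow (by positivity) ht0.le, Real.mul_rpow (by positivity) ht0.le] at h4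
    rw [Real.rpow_add ht0, Real.rpow_add ht0, Real.rpow_one]
    calc _ = _ := by ring
      _ ≤ _ := h4
      _ = _ := by ring
  set A : ℝ := 2 ^ (α - n) * kap n * (kap n * p / q) ^ (1 / q) with hA
  set B : ℝ := c * (D ^ (q / dualExp p * γ)) * kap n ^ (1 / p) with hB
  have hA0 : 0 < A := by positivity
  have hε : 0 < (1 + 1 / q) - (q / dualExp p * γ + 1 / p) := by
    have h1 : q / dualExp p * γ < q / dualExp p * (dualExp p / q * (1 - α / n)) := by gcongr
    have h2 : q / dualExp p * (dualExp p / q * (1 - α / n)) = 1 - α / n := by field_simp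
    rw [hq]
    linarith
  obtain ⟨t, ht1, ht2⟩ := ((Filter.eventually_gt_atTop (1:ℝ)).and
    ((tendsto_rpow_atTop hε).eventually_gt_atTop (B / A))).exists
  have ht0 : 0 < t := by linarith
  have h := key t ht1
  rw [Real.rpow_sub ht0, div_lt_div_iff₀ hA0 (by positivity)] at ht2
  linarith

end
end
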